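/- Let X be a standard Gaussian vector in ℝⁿ and 1 ≤ p ≤ 2. Then there exist absolute constants c₁, C₁, c₂, C₂ > 0 such that for all 0 < ε < 1, c₁·exp(−C₁ε²n) ≤ P(|‖X‖_p − E‖X‖_p| > ε·E‖X‖_p) ≤ C₂·exp(−c₂ε²n). -/

import Mathlib

open MeasureTheory ProbabilityTheory

/-- The constant in the sub-gaussian estimate `integral_mul_exp_le`. -/
noncomputable def mgfConst : ℝ := 256 * ∫ x : ℝ, Real.exp ((5 + x ^ 2) / 4) ∂(gaussianReal 0 1)

lemma integrable_exp_sq_div_four :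
    Integrable (fun x : ℝ => Real.exp ((5 + x ^ 2) / 4)) (gaussianReal 0 1) := by
  rw [gaussianReal_of_var_ne_zero 0 one_ne_zero, gaussianPDF_def,
    integrable_withDensity_iff (by fun_prop) (by simp)]
  have h := ((integrable_exp_neg_mul_sq (b := 1 / 4) (by norm_num)).const_mul
    (Real.exp (5 / 4) * (√(2 * Real.pi))⁻¹))
  refine h.congr (ae_of_all _ fun x => ?_)
  beta_reduce
  rw [ENNReal.toReal_ofReal (gaussianPDFReal_nonneg _ _ _), gaussianPDFReal, mul_left_comm,
    ← Real.exp_add, mul_comm (Real.exp (5 / 4)), mul_assoc, ← Real.exp_add]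
  simp only [NNReal.coe_one, mul_one, sub_zero]
  ring_nf

lemma mgfConst_pos : 0 < mgfConst := by
  have h : (∫ _ : ℝ, (1 : ℝ) ∂(gaussianReal 0 1)) ≤
      ∫ x : ℝ, Real.exp ((5 + x ^ 2) / 4) ∂(gaussianReal 0 1) :=
    integral_mono (integrable_const _) integrable_exp_sq_div_four
      fun x => Real.one_le_exp (by positivity)
  simp only [integral_const, probReal_univ, smul_eq_mul, mul_one] at h
  unfold mgfConst
  linarith

lemma integral_sq_gaussianReal :
    ∫ x : ℝ, x ^ 2 ∂(gaussianReal 0 1) = 1 := by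
  have h := variance_fun_id_gaussianReal (μ := 0) (v := 1)
  rw [variance_of_integral_eq_zero (by fun_prop) (by simp)] at h
  simpa using h

lemma integrable_one_add_sq :
    Integrable (fun x : ℝ => 1 + x ^ 2) (gaussianReal 0 1) := by
  refine integrable_exp_sq_div_four.const_mul 4 |>.mono' (by fun_prop) (ae_of_all _ fun x => ?_)
  rw [Real.norm_eq_abs, abs_of_nonneg (by positivity)]
  linarith [Real.add_one_le_exp ((5 + x ^ 2) / 4)]

lemma integral_one_add_sq :
    ∫ x : ℝ, (1 + x ^ 2) ∂(gaussianReal 0 1) = 2 := by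
  have h : Integrable (fun x : ℝ => x ^ 2) (gaussianReal 0 1) := by
    refine (integrable_one_add_sq.sub (integrable_const 1)).congr (ae_of_all _ fun x => ?_)
    simp
  rw [integral_add (integrable_const _) h, integral_sq_gaussianReal]
  simp
  norm_num

lemma exp_le_one_add_add_sq_mul_exp_abs (y : ℝ) :
    Real.exp y ≤ 1 + y + y ^ 2 * Real.exp |y| := by
  have h := Complex.norm_exp_sub_sum_le_norm_mul_exp (y : ℂ) 2
  have h2 : Complex.exp y - ∑ m ∈ Finset.range 2, (y : ℂ) ^ m / (m.factorial : ℂ) =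
      ((Real.exp y - (1 + y) : ℝ) : ℂ) := by
    simp [Finset.sum_range_succ]
  rw [h2, Complex.norm_real, Complex.norm_real, Real.norm_eq_abs, Real.norm_eq_abs, sq_abs] at h
  linarith [le_abs_self (Real.exp y - (1 + y))]

lemma sq_mul_exp_abs_le {l y u : ℝ} (hu : 0 ≤ u) (hl : |l| ≤ 1 / 8) (hy : |y| ≤ u) :
    (l * y) ^ 2 * Real.exp |l * y| ≤ 128 * l ^ 2 * Real.exp (u / 4) := by
  have h1 : |l * y| ≤ u / 8 := by
    rw [abs_mul]
    nlinarith [abs_nonneg l, abs_nonneg y]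
  have h2 : y ^ 2 ≤ 128 * Real.exp (u / 8) := by
    have := Real.quadratic_le_exp_of_nonneg (x := u / 8) (by positivity)
    have h3 : y ^ 2 ≤ u ^ 2 := sq_le_sq' (by linarith [neg_abs_le y]) (by linarith [le_abs_self y])
    nlinarith
  calc (l * y) ^ 2 * Real.exp |l * y| ≤ (l ^ 2 * (128 * Real.exp (u / 8))) * Real.exp (u / 8) := by
        rw [mul_pow]; gcongr
    _ = 128 * l ^ 2 * Real.exp (u / 4) := by
        rw [show u / 4 = u / 8 + u / 8 by ring, Real.exp_add]; ring

section Tilt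

variable {w f : ℝ → ℝ}

lemma integrable_of_le_one_add_sq (hf : Measurable f) (hf0 : ∀ x, 0 ≤ f x)
    (hf1 : ∀ x, f x ≤ 1 + x ^ 2) : Integrable f (gaussianReal 0 1) := by
  refine integrable_one_add_sq.mono' hf.aestronglyMeasurable (ae_of_all _ fun x => ?_)
  rw [Real.norm_eq_abs, abs_of_nonneg (hf0 x)]
  exact hf1 x

lemma integrable_mul_of_le_one_add_sq (hw : Measurable w) (hw0 : ∀ x, 0 ≤ w x)
    (hw2 : ∀ x, w x ≤ 2) (hf : Measurable f) (hf0 : ∀ x, 0 ≤ f x) (hf1 : ∀ x, f x ≤ 1 + x ^ 2) :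
    Integrable (fun x => w x * f x) (gaussianReal 0 1) := by
  refine (integrable_of_le_one_add_sq hf hf0 hf1).bdd_mul hw.aestronglyMeasurable (c := 2)
    (ae_of_all _ fun x => ?_)
  rw [Real.norm_eq_abs, abs_of_nonneg (hw0 x)]
  exact hw2 x

lemma integrable_of_nonneg_of_le_two (hw : Measurable w) (hw0 : ∀ x, 0 ≤ w x)
    (hw2 : ∀ x, w x ≤ 2) : Integrable w (gaussianReal 0 1) := by
  refine Integrable.of_bound hw.aestronglyMeasurable 2 (ae_of_all _ fun x => ?_)
  rw [Real.norm_eq_abs, abs_of_nonneg (hw0 x)]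
  exact hw2 x

lemma abs_sub_integral_le (hw : Measurable w) (hw0 : ∀ x, 0 ≤ w x) (hw2 : ∀ x, w x ≤ 2)
    (hf : Measurable f) (hf0 : ∀ x, 0 ≤ f x) (hf1 : ∀ x, f x ≤ 1 + x ^ 2) (x : ℝ) :
    |f x - ∫ y, w y * f y ∂(gaussianReal 0 1)| ≤ 5 + x ^ 2 := by
  have h0 : 0 ≤ ∫ y, w y * f y ∂(gaussianReal 0 1) :=
    integral_nonneg fun y => mul_nonneg (hw0 y) (hf0 y)
  have h1 : ∫ y, w y * f y ∂(gaussianReal 0 1) ≤ ∫ y, 2 * (1 + y ^ 2) ∂(gaussianReal 0 1) := by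
    refine integral_mono (integrable_mul_of_le_one_add_sq hw hw0 hw2 hf hf0 hf1)
      (integrable_one_add_sq.const_mul 2) fun y => ?_
    exact mul_le_mul (hw2 y) (hf1 y) (hf0 y) zero_le_two
  rw [integral_const_mul, integral_one_add_sq] at h1
  rw [abs_le]
  constructor <;> nlinarith [hf0 x, hf1 x, sq_nonneg x]

lemma exp_mul_le_quadratic (hw : Measurable w) (hw0 : ∀ x, 0 ≤ w x) (hw2 : ∀ x, w x ≤ 2)
    (hf : Measurable f) (hf0 : ∀ x, 0 ≤ f x) (hf1 : ∀ x, f x ≤ 1 + x ^ 2) {l : ℝ}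
    (hl : |l| ≤ 1 / 8) (x : ℝ) :
    w x * Real.exp (l * (f x - ∫ y, w y * f y ∂(gaussianReal 0 1))) ≤
      (w x + l * (w x * f x - (∫ y, w y * f y ∂(gaussianReal 0 1)) * w x)) +
        256 * l ^ 2 * Real.exp ((5 + x ^ 2) / 4) := by
  set m := ∫ y, w y * f y ∂(gaussianReal 0 1) with hm
  have h1 := exp_le_one_add_add_sq_mul_exp_abs (l * (f x - m))
  have h2 := sq_mul_exp_abs_le (by positivity) hl
    (abs_sub_integral_le hw hw0 hw2 hf hf0 hf1 x)
  rw [← hm] at h2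
  calc w x * Real.exp (l * (f x - m))
      ≤ w x * (1 + l * (f x - m) + 128 * l ^ 2 * Real.exp ((5 + x ^ 2) / 4)) := by
        gcongr
        · exact hw0 x
        · linarith
    _ ≤ w x * (1 + l * (f x - m)) + 2 * (128 * l ^ 2 * Real.exp ((5 + x ^ 2) / 4)) := by
        rw [mul_add]
        gcongr
        exact hw2 x
    _ = _ := by ring

lemma integrable_quadratic (hw : Measurable w) (hw0 : ∀ x, 0 ≤ w x) (hw2 : ∀ x, w x ≤ 2)
    (hf : Measurable f) (hf0 : ∀ x, 0 ≤ f x) (hf1 : ∀ x, f x ≤ 1 + x ^ 2) (l m : ℝ) :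
    Integrable (fun x => w x + l * (w x * f x - m * w x)) (gaussianReal 0 1) :=
  (integrable_of_nonneg_of_le_two hw hw0 hw2).add
    (((integrable_mul_of_le_one_add_sq hw hw0 hw2 hf hf0 hf1).sub
      ((integrable_of_nonneg_of_le_two hw hw0 hw2).const_mul m)).const_mul l)

lemma integrable_mul_exp (hw : Measurable w) (hw0 : ∀ x, 0 ≤ w x) (hw2 : ∀ x, w x ≤ 2)
    (hf : Measurable f) (hf0 : ∀ x, 0 ≤ f x) (hf1 : ∀ x, f x ≤ 1 + x ^ 2) {l : ℝ}
    (hl : |l| ≤ 1 / 8) :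
    Integrable (fun x => w x * Real.exp (l * (f x - ∫ y, w y * f y ∂(gaussianReal 0 1))))
      (gaussianReal 0 1) := by
  refine ((integrable_quadratic hw hw0 hw2 hf hf0 hf1 l
    (∫ y, w y * f y ∂(gaussianReal 0 1))).add
    (integrable_exp_sq_div_four.const_mul (256 * l ^ 2))).mono'
    (by fun_prop) (ae_of_all _ fun x => ?_)
  rw [Real.norm_eq_abs, abs_of_nonneg (mul_nonneg (hw0 x) (Real.exp_pos _).le)]
  exact exp_mul_le_quadratic hw hw0 hw2 hf hf0 hf1 hl x

lemma integral_mul_exp_le (hw : Measurable w) (hw0 : ∀ x, 0 ≤ w x) (hw2 : ∀ x, w x ≤ 2)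
    (hw1 : ∫ x, w x ∂(gaussianReal 0 1) = 1)
    (hf : Measurable f) (hf0 : ∀ x, 0 ≤ f x) (hf1 : ∀ x, f x ≤ 1 + x ^ 2) {l : ℝ}
    (hl : |l| ≤ 1 / 8) :
    ∫ x, w x * Real.exp (l * (f x - ∫ y, w y * f y ∂(gaussianReal 0 1))) ∂(gaussianReal 0 1) ≤
      Real.exp (mgfConst * l ^ 2) := by
  have hwi := integrable_of_nonneg_of_le_two hw hw0 hw2
  have hwf := integrable_mul_of_le_one_add_sq hw hw0 hw2 hf hf0 hf1
  have hlin : Integrable (fun x => l * (w x * f x - (∫ y, w y * f y ∂(gaussianReal 0 1)) * w x))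
      (gaussianReal 0 1) := (hwf.sub (hwi.const_mul _)).const_mul l
  refine (integral_mono (integrable_mul_exp hw hw0 hw2 hf hf0 hf1 hl)
    ((integrable_quadratic hw hw0 hw2 hf hf0 hf1 l _).add
      (integrable_exp_sq_div_four.const_mul (256 * l ^ 2)))
    (exp_mul_le_quadratic hw hw0 hw2 hf hf0 hf1 hl)).trans ?_
  simp only [Pi.add_apply]
  rw [integral_add (integrable_quadratic hw hw0 hw2 hf hf0 hf1 l _)
      (integrable_exp_sq_div_four.const_mul (256 * l ^ 2)),
    integral_add hwi hlin, integral_const_mul,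
    integral_sub hwf (hwi.const_mul _), integral_const_mul, integral_const_mul, hw1]
  have := Real.add_one_le_exp (mgfConst * l ^ 2)
  unfold mgfConst at this ⊢
  linarith

variable {n : ℕ}

lemma prod_mul_exp_eq (w f : ℝ → ℝ) (l m : ℝ) (x : Fin n → ℝ) :
    ∏ i, (w (x i) * Real.exp (l * (f (x i) - m))) =
      (∏ i, w (x i)) * Real.exp (l * ∑ i, (f (x i) - m)) := by
  rw [Finset.prod_mul_distrib, ← Real.exp_sum, Finset.mul_sum]

lemma integrable_prod_mul_exp (hw : Measurable w) (hw0 : ∀ x, 0 ≤ w x) (hw2 : ∀ x, w x ≤ 2)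
    (hf : Measurable f) (hf0 : ∀ x, 0 ≤ f x) (hf1 : ∀ x, f x ≤ 1 + x ^ 2) {l : ℝ}
    (hl : |l| ≤ 1 / 8) :
    Integrable (fun x : Fin n → ℝ => (∏ i, w (x i)) *
        Real.exp (l * ∑ i, (f (x i) - ∫ y, w y * f y ∂(gaussianReal 0 1))))
      (Measure.pi fun _ : Fin n => gaussianReal 0 1) := by
  simp_rw [← prod_mul_exp_eq]
  exact Integrable.fintype_prod (f := fun _ x => w x *
    Real.exp (l * (f x - ∫ y, w y * f y ∂(gaussianReal 0 1))))
    fun _ => integrable_mul_exp hw hw0 hw2 hf hf0 hf1 hl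

lemma integral_prod_mul_exp_le (hw : Measurable w) (hw0 : ∀ x, 0 ≤ w x) (hw2 : ∀ x, w x ≤ 2)
    (hw1 : ∫ x, w x ∂(gaussianReal 0 1) = 1)
    (hf : Measurable f) (hf0 : ∀ x, 0 ≤ f x) (hf1 : ∀ x, f x ≤ 1 + x ^ 2) {l : ℝ}
    (hl : |l| ≤ 1 / 8) :
    ∫ x, (∏ i, w (x i)) *
        Real.exp (l * ∑ i, (f (x i) - ∫ y, w y * f y ∂(gaussianReal 0 1)))
      ∂(Measure.pi fun _ : Fin n => gaussianReal 0 1) ≤ Real.exp (mgfConst * l ^ 2 * n) := by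
  simp_rw [← prod_mul_exp_eq]
  rw [integral_fintype_prod_eq_pow (fun x => w x *
    Real.exp (l * (f x - ∫ y, w y * f y ∂(gaussianReal 0 1)))), Fintype.card_fin,
    mul_comm _ (n : ℝ), Real.exp_nat_mul]
  exact pow_le_pow_left₀ (integral_nonneg fun x => mul_nonneg (hw0 x) (Real.exp_pos _).le)
    (integral_mul_exp_le hw hw0 hw2 hw1 hf hf0 hf1 hl) n

/-- **Chernoff bound** for the tilted product measure with density `∏ i, w (x i)`. -/
lemma setIntegral_prod_le (hw : Measurable w) (hw0 : ∀ x, 0 ≤ w x) (hw2 : ∀ x, w x ≤ 2)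
    (hw1 : ∫ x, w x ∂(gaussianReal 0 1) = 1)
    (hf : Measurable f) (hf0 : ∀ x, 0 ≤ f x) (hf1 : ∀ x, f x ≤ 1 + x ^ 2) {l : ℝ}
    (hl : |l| ≤ 1 / 8) (r : ℝ) :
    ∫ x in {x | r ≤ l * ∑ i, (f (x i) - ∫ y, w y * f y ∂(gaussianReal 0 1))}, (∏ i, w (x i))
      ∂(Measure.pi fun _ : Fin n => gaussianReal 0 1) ≤
      Real.exp (-r + mgfConst * l ^ 2 * n) := by
  set m := ∫ y, w y * f y ∂(gaussianReal 0 1) with hm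
  have hI := integrable_prod_mul_exp (n := n) hw hw0 hw2 hf hf0 hf1 hl
  rw [← hm] at hI
  have hms : MeasurableSet {x : Fin n → ℝ | r ≤ l * ∑ i, (f (x i) - m)} :=
    measurableSet_le measurable_const (by fun_prop)
  have hW : Integrable (fun x : Fin n → ℝ => ∏ i, w (x i))
      (Measure.pi fun _ : Fin n => gaussianReal 0 1) :=
    Integrable.fintype_prod (f := fun _ => w) fun _ => integrable_of_nonneg_of_le_two hw hw0 hw2
  have hW0 : ∀ x : Fin n → ℝ, 0 ≤ ∏ i, w (x i) := fun x => Finset.prod_nonneg fun i _ => hw0 _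
  calc _ ≤ ∫ x in {x | r ≤ l * ∑ i, (f (x i) - m)}, Real.exp (-r) * ((∏ i, w (x i)) *
            Real.exp (l * ∑ i, (f (x i) - m))) ∂(Measure.pi fun _ : Fin n => gaussianReal 0 1) := by
        refine setIntegral_mono_on hW.integrableOn (hI.const_mul _).integrableOn hms fun x hx => ?_
        rw [mul_left_comm, ← Real.exp_add]
        refine le_mul_of_one_le_right (hW0 x) (Real.one_le_exp ?_)
        rw [Set.mem_ofPred_eq] at hx
        linarith
    _ ≤ ∫ x, Real.exp (-r) * ((∏ i, w (x i)) * Real.exp (l * ∑ i, (f (x i) - m)))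
          ∂(Measure.pi fun _ : Fin n => gaussianReal 0 1) :=
        setIntegral_le_integral (hI.const_mul _) (ae_of_all _ fun x =>
          mul_nonneg (Real.exp_pos _).le (mul_nonneg (hW0 x) (Real.exp_pos _).le))
    _ ≤ _ := by
        rw [integral_const_mul, Real.exp_add]
        gcongr
        exact integral_prod_mul_exp_le hw hw0 hw2 hw1 hf hf0 hf1 hl

end Tilt

/-- The two-sided tail of the standard Gaussian distribution. -/
noncomputable def gaussianTail (a : ℝ) : ℝ := (gaussianReal 0 1).real {x | a < |x|}

lemma gaussianReal_real_pos_of_isOpen {s : Set ℝ} (hs : IsOpen s) (hne : s.Nonempty) :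
    0 < (gaussianReal 0 1).real s := by
  rw [measureReal_def, ENNReal.toReal_pos_iff]
  refine ⟨pos_iff_ne_zero.2 fun h => ?_, measure_lt_top _ _⟩
  exact (hs.measure_pos volume hne).ne' (gaussianReal_absolutelyContinuous' 0 one_ne_zero h)

lemma isOpen_lt_abs (a : ℝ) : IsOpen {x : ℝ | a < |x|} :=
  isOpen_lt continuous_const continuous_abs

lemma gaussianTail_pos (a : ℝ) : 0 < gaussianTail a := by
  refine gaussianReal_real_pos_of_isOpen (isOpen_lt_abs a) ⟨|a| + 1, ?_⟩
  rw [Set.mem_ofPred_eq, abs_of_nonneg (by positivity)]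
  linarith [le_abs_self a]

lemma gaussianTail_le_one (a : ℝ) : gaussianTail a ≤ 1 := measureReal_le_one

lemma gaussianTail_one_lt_one : gaussianTail 1 < 1 := by
  have h := gaussianReal_real_pos_of_isOpen (s := {x : ℝ | |x| < 1})
    (isOpen_lt continuous_abs continuous_const) ⟨0, by simp⟩
  have h2 : (gaussianReal 0 1).real {x : ℝ | |x| < 1} ≤
      (gaussianReal 0 1).real {x : ℝ | 1 < |x|}ᶜ := by
    refine measureReal_mono fun x hx => ?_
    simp only [Set.mem_ofPred_eq, Set.mem_compl_iff, not_lt] at hx ⊢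
    exact hx.le
  rw [probReal_compl_eq_one_sub (isOpen_lt_abs 1).measurableSet] at h2
  unfold gaussianTail
  linarith

lemma abs_rpow_le_one_add_sq {p : ℝ} (hp1 : 1 ≤ p) (hp2 : p ≤ 2) (x : ℝ) :
    |x| ^ p ≤ 1 + x ^ 2 := by
  rcases le_total |x| 1 with h | h
  · have := Real.rpow_le_one (abs_nonneg x) h (by linarith : 0 ≤ p)
    nlinarith [sq_nonneg x]
  · have := Real.rpow_le_rpow_of_exponent_le h hp2
    rw [Real.rpow_two, sq_abs] at this
    linarith

/-- The absolute moment of order `p` of the standard Gaussian distribution. -/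
noncomputable def gaussianAbsMoment (p : ℝ) : ℝ := ∫ x : ℝ, |x| ^ p ∂(gaussianReal 0 1)

lemma measurable_abs_rpow (p : ℝ) : Measurable fun x : ℝ => |x| ^ p :=
  (continuous_abs.measurable).pow_const p

lemma abs_rpow_nonneg (p x : ℝ) : 0 ≤ |x| ^ p := Real.rpow_nonneg (abs_nonneg x) p

lemma integrable_abs_rpow {p : ℝ} (hp1 : 1 ≤ p) (hp2 : p ≤ 2) :
    Integrable (fun x : ℝ => |x| ^ p) (gaussianReal 0 1) :=
  integrable_of_le_one_add_sq (measurable_abs_rpow p) (abs_rpow_nonneg p)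
    (abs_rpow_le_one_add_sq hp1 hp2)

lemma gaussianAbsMoment_le_two {p : ℝ} (hp1 : 1 ≤ p) (hp2 : p ≤ 2) :
    gaussianAbsMoment p ≤ 2 := by
  rw [← integral_one_add_sq]
  exact integral_mono (integrable_abs_rpow hp1 hp2) integrable_one_add_sq
    (abs_rpow_le_one_add_sq hp1 hp2)

lemma gaussianTail_le_gaussianAbsMoment {p : ℝ} (hp1 : 1 ≤ p) (hp2 : p ≤ 2) :
    gaussianTail 1 ≤ gaussianAbsMoment p := by
  have hm : MeasurableSet {x : ℝ | 1 < |x|} := (isOpen_lt_abs 1).measurableSet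
  unfold gaussianTail gaussianAbsMoment
  rw [← integral_indicator_one hm]
  refine integral_mono ((integrable_const 1).indicator hm) (integrable_abs_rpow hp1 hp2)
    fun x => Set.indicator_le' (fun y hy => ?_) (fun y _ => abs_rpow_nonneg p y) x
  exact Real.one_le_rpow (le_of_lt hy) (by linarith)

lemma gaussianAbsMoment_pos {p : ℝ} (hp1 : 1 ≤ p) (hp2 : p ≤ 2) : 0 < gaussianAbsMoment p :=
  (gaussianTail_pos 1).trans_le (gaussianTail_le_gaussianAbsMoment hp1 hp2)

/-- The slope of the optimal exponential parameter in the Chernoff bounds. -/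
noncomputable def chernoffSlope : ℝ := min (1 / 8) (gaussianTail 1 / (2 * mgfConst))

lemma chernoffSlope_pos : 0 < chernoffSlope := by
  have := gaussianTail_pos 1
  have := mgfConst_pos
  unfold chernoffSlope
  positivity

/-- The exponential rate in the Chernoff bounds. -/
noncomputable def chernoffRate : ℝ := chernoffSlope * gaussianTail 1 / 2

lemma chernoffRate_pos : 0 < chernoffRate := by
  have := gaussianTail_pos 1
  have := chernoffSlope_pos
  unfold chernoffRate
  positivity

lemma abs_chernoffSlope_mul_le {d : ℝ} (hd0 : 0 ≤ d) (hd1 : d ≤ 1) :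
    |chernoffSlope * d| ≤ 1 / 8 := by
  have h : chernoffSlope ≤ 1 / 8 := min_le_left _ _
  have := chernoffSlope_pos
  rw [abs_of_nonneg (by positivity)]
  nlinarith

lemma chernoff_exponent_le {p : ℝ} (hp1 : 1 ≤ p) (hp2 : p ≤ 2) (d : ℝ) (n : ℕ) :
    -(chernoffSlope * d ^ 2 * gaussianAbsMoment p * n) + mgfConst * (chernoffSlope * d) ^ 2 * n ≤
      -chernoffRate * d ^ 2 * n := by
  have h : chernoffSlope * (2 * mgfConst) ≤ gaussianTail 1 := by
    rw [← le_div_iff₀ (by linarith [mgfConst_pos])]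
    exact min_le_right _ _
  have hm := gaussianTail_le_gaussianAbsMoment hp1 hp2
  have h0 : 0 ≤ chernoffSlope * d ^ 2 * n :=
    mul_nonneg (mul_nonneg chernoffSlope_pos.le (sq_nonneg d)) n.cast_nonneg
  unfold chernoffRate
  nlinarith [mul_le_mul_of_nonneg_left h h0, mul_le_mul_of_nonneg_left hm h0]

section Sum

variable {n : ℕ} {p : ℝ}

lemma sum_abs_rpow_sub (m : ℝ) (x : Fin n → ℝ) :
    ∑ i, (|x i| ^ p - m) = (∑ i, |x i| ^ p) - n * m := by
  simp

lemma measureReal_le_of_le_mul (hp1 : 1 ≤ p) (hp2 : p ≤ 2) {l : ℝ} (hl : |l| ≤ 1 / 8) (r : ℝ) :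
    (Measure.pi fun _ : Fin n => gaussianReal 0 1).real
        {x | r ≤ l * ((∑ i, |x i| ^ p) - n * gaussianAbsMoment p)} ≤
      Real.exp (-r + mgfConst * l ^ 2 * n) := by
  have h := setIntegral_prod_le (n := n) (w := fun _ => 1) measurable_const (by simp) (by simp)
    (by simp) (measurable_abs_rpow p) (abs_rpow_nonneg p) (abs_rpow_le_one_add_sq hp1 hp2) hl r
  simpa [gaussianAbsMoment] using h

lemma measureReal_abs_sum_sub_le (hp1 : 1 ≤ p) (hp2 : p ≤ 2) {d : ℝ} (hd0 : 0 ≤ d) (hd1 : d ≤ 1) :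
    (Measure.pi fun _ : Fin n => gaussianReal 0 1).real
        {x | d * (n * gaussianAbsMoment p) ≤ |(∑ i, |x i| ^ p) - n * gaussianAbsMoment p|} ≤
      2 * Real.exp (-chernoffRate * d ^ 2 * n) := by
  have hl := abs_chernoffSlope_mul_le hd0 hd1
  have hs : 0 ≤ chernoffSlope * d := mul_nonneg chernoffSlope_pos.le hd0
  have h1 := measureReal_le_of_le_mul (n := n) hp1 hp2 hl
    (chernoffSlope * d ^ 2 * gaussianAbsMoment p * n)
  have h2 := measureReal_le_of_le_mul (n := n) hp1 hp2 ((abs_neg _).trans_le hl)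
    (chernoffSlope * d ^ 2 * gaussianAbsMoment p * n)
  rw [neg_sq] at h2
  have he := Real.exp_le_exp.2 (chernoff_exponent_le hp1 hp2 d n)
  refine (measureReal_mono (fun x hx => ?_)).trans ((measureReal_union_le _ _).trans
    ((add_le_add h1 h2).trans (by linarith)))
  rw [Set.mem_ofPred_eq] at hx
  have hx' := mul_le_mul_of_nonneg_left hx hs
  rw [Set.mem_union, Set.mem_ofPred_eq, Set.mem_ofPred_eq]
  rcases abs_cases ((∑ i, |x i| ^ p) - n * gaussianAbsMoment p) with ⟨h, -⟩ | ⟨h, -⟩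
  · left; rw [h] at hx'; linarith
  · right; rw [h] at hx'; linarith

lemma integrable_abs_rpow_eval (hp1 : 1 ≤ p) (hp2 : p ≤ 2) (i : Fin n) :
    Integrable (fun x : Fin n → ℝ => |x i| ^ p) (Measure.pi fun _ : Fin n => gaussianReal 0 1) :=
  integrable_comp_eval (μ := fun _ : Fin n => gaussianReal 0 1) (i := i)
    (f := fun x : ℝ => |x| ^ p) (integrable_abs_rpow hp1 hp2)

lemma integrable_sum_abs_rpow (hp1 : 1 ≤ p) (hp2 : p ≤ 2) :
    Integrable (fun x : Fin n → ℝ => ∑ i, |x i| ^ p)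
      (Measure.pi fun _ : Fin n => gaussianReal 0 1) :=
  integrable_finsetSum _ fun i _ => integrable_abs_rpow_eval hp1 hp2 i

lemma integral_sum_abs_rpow (hp1 : 1 ≤ p) (hp2 : p ≤ 2) :
    ∫ x : Fin n → ℝ, ∑ i, |x i| ^ p ∂(Measure.pi fun _ : Fin n => gaussianReal 0 1) =
      n * gaussianAbsMoment p := by
  rw [integral_finsetSum _ fun i _ => integrable_abs_rpow_eval hp1 hp2 i]
  have h : ∀ i : Fin n, ∫ x : Fin n → ℝ, |x i| ^ p
      ∂(Measure.pi fun _ : Fin n => gaussianReal 0 1) = gaussianAbsMoment p := fun i =>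
    integral_comp_eval (μ := fun _ : Fin n => gaussianReal 0 1) (i := i) (f := fun x : ℝ => |x| ^ p)
      (integrable_abs_rpow hp1 hp2).aestronglyMeasurable
  simp [h]

lemma integral_abs_sum_sub_le (hn : 0 < n) (hp1 : 1 ≤ p) (hp2 : p ≤ 2) :
    ∫ x : Fin n → ℝ, |(∑ i, |x i| ^ p) - n * gaussianAbsMoment p|
        ∂(Measure.pi fun _ : Fin n => gaussianReal 0 1) ≤
      16 * Real.exp (mgfConst / 64) * √n := by
  have hn' : (1 : ℝ) ≤ n := by exact_mod_cast hn
  have hsq : 1 ≤ √(n : ℝ) := Real.one_le_sqrt.2 hn'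
  have hs0 : 0 < √(n : ℝ) := by linarith
  set l : ℝ := 1 / (8 * √n) with hldef
  have hl0 : 0 < l := by positivity
  have hl : |l| ≤ 1 / 8 := by
    rw [abs_of_pos hl0, hldef]
    exact one_div_le_one_div_of_le (by norm_num) (by linarith)
  have hl2 : mgfConst * l ^ 2 * n = mgfConst / 64 := by
    rw [hldef, div_pow, mul_pow, Real.sq_sqrt (by linarith)]
    field_simp
    norm_num
  have hE : ∀ l : ℝ, |l| ≤ 1 / 8 →
      Integrable (fun x : Fin n → ℝ =>
        Real.exp (l * ((∑ i, |x i| ^ p) - n * gaussianAbsMoment p)))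
        (Measure.pi fun _ : Fin n => gaussianReal 0 1) ∧
      ∫ x : Fin n → ℝ, Real.exp (l * ((∑ i, |x i| ^ p) - n * gaussianAbsMoment p))
        ∂(Measure.pi fun _ : Fin n => gaussianReal 0 1) ≤ Real.exp (mgfConst * l ^ 2 * n) := by
    intro l hl
    have h1 := integrable_prod_mul_exp (n := n) (w := fun _ => 1) measurable_const (by simp)
      (by simp) (measurable_abs_rpow p) (abs_rpow_nonneg p) (abs_rpow_le_one_add_sq hp1 hp2) hl
    have h2 := integral_prod_mul_exp_le (n := n) (w := fun _ => 1) measurable_const (by simp)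
      (by simp) (by simp) (measurable_abs_rpow p) (abs_rpow_nonneg p)
      (abs_rpow_le_one_add_sq hp1 hp2) hl
    simp only [Finset.prod_const_one, one_mul, sum_abs_rpow_sub] at h1 h2
    exact ⟨h1, h2⟩
  obtain ⟨hi1, hb1⟩ := hE l hl
  obtain ⟨hi2, hb2⟩ := hE (-l) ((abs_neg l).trans_le hl)
  rw [neg_sq] at hb2
  rw [hl2] at hb1 hb2
  have hmain := integral_mono
    (((integrable_sum_abs_rpow (n := n) hp1 hp2).sub
      (integrable_const (n * gaussianAbsMoment p))).abs.const_mul l) (hi1.add hi2) fun x => by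
    show l * |(∑ i, |x i| ^ p) - n * gaussianAbsMoment p| ≤
      Real.exp (l * ((∑ i, |x i| ^ p) - n * gaussianAbsMoment p)) +
        Real.exp (-l * ((∑ i, |x i| ^ p) - n * gaussianAbsMoment p))
    set z := (∑ i, |x i| ^ p) - n * gaussianAbsMoment p
    have e1 := Real.add_one_le_exp (l * z)
    have e2 := Real.add_one_le_exp (-l * z)
    have e3 := Real.exp_pos (l * z)
    have e4 := Real.exp_pos (-l * z)
    rcases abs_cases z with ⟨h, -⟩ | ⟨h, -⟩ <;> rw [h] <;> linarith
  simp only [Pi.add_apply, Pi.sub_apply] at hmain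
  rw [integral_const_mul, integral_add hi1 hi2] at hmain
  have h3 : l * ∫ x : Fin n → ℝ, |(∑ i, |x i| ^ p) - n * gaussianAbsMoment p|
      ∂(Measure.pi fun _ : Fin n => gaussianReal 0 1) ≤ 2 * Real.exp (mgfConst / 64) := by
    linarith
  rw [hldef, div_mul_eq_mul_div, one_mul, div_le_iff₀ (by positivity)] at h3
  linarith

end Sum

section RpowInv

variable {q r t : ℝ}

lemma abs_rpow_sub_rpow_le (hq0 : 0 ≤ q) (hq1 : q ≤ 1) (hr : 0 < r) (ht : 0 ≤ t) :
    |t ^ q - r ^ q| ≤ r ^ q * (|t - r| / r) := by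
  have hs : 0 ≤ t / r := by positivity
  have hfac : t ^ q - r ^ q = r ^ q * ((t / r) ^ q - 1) := by
    rw [Real.div_rpow ht hr.le]
    have := (Real.rpow_pos_of_pos hr q).ne'
    field_simp
  have hd : |t - r| / r = |t / r - 1| := by
    rw [← abs_of_pos hr, ← abs_div, abs_of_pos hr, sub_div, div_self hr.ne']
  rw [hfac, hd, abs_mul, abs_of_pos (Real.rpow_pos_of_pos hr q)]
  refine mul_le_mul_of_nonneg_left ?_ (Real.rpow_pos_of_pos hr q).le
  rcases le_total 1 (t / r) with h | h
  · have h1 := Real.one_le_rpow h hq0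
    have h2 := Real.rpow_le_rpow_of_exponent_le h hq1
    rw [Real.rpow_one] at h2
    rw [abs_of_nonneg (by linarith), abs_of_nonneg (by linarith)]
    linarith
  · have h1 := Real.rpow_le_one hs h hq0
    have h2 := Real.rpow_le_rpow_of_exponent_ge' hs h hq0 hq1
    rw [Real.rpow_one] at h2
    rw [abs_of_nonpos (by linarith), abs_of_nonpos (by linarith)]
    linarith

lemma rpow_le_tangent (hq0 : 0 ≤ q) (hq1 : q ≤ 1) (hr : 0 < r) (ht : 0 ≤ t) :
    t ^ q ≤ r ^ q + r ^ q * (q / r) * (t - r) := by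
  have h := rpow_one_add_le_one_add_mul_self (s := t / r - 1)
    (by linarith [div_nonneg ht hr.le]) hq0 hq1
  rw [add_sub_cancel, Real.div_rpow ht hr.le, div_le_iff₀ (Real.rpow_pos_of_pos hr q)] at h
  refine h.trans_eq ?_
  field_simp

end RpowInv

section Norm

variable {n : ℕ} {p : ℝ}

/-- The mean of the `ℓ_p` norm of a standard Gaussian vector in `ℝⁿ`. -/
noncomputable def gaussianMeanNorm (n : ℕ) (p : ℝ) : ℝ :=
  ∫ y, (∑ i, |y i| ^ p) ^ (1 / p) ∂(Measure.pi fun _ : Fin n => gaussianReal 0 1)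

lemma sum_abs_rpow_nonneg (p : ℝ) (x : Fin n → ℝ) : 0 ≤ ∑ i, |x i| ^ p :=
  Finset.sum_nonneg fun i _ => abs_rpow_nonneg p (x i)

lemma one_div_mem_of_one_le (hp1 : 1 ≤ p) : 0 ≤ 1 / p ∧ 1 / p ≤ 1 :=
  ⟨by positivity, by rw [div_le_one (by linarith)]; exact hp1⟩

lemma mul_gaussianAbsMoment_pos (hn : 0 < n) (hp1 : 1 ≤ p) (hp2 : p ≤ 2) :
    0 < n * gaussianAbsMoment p :=
  mul_pos (by exact_mod_cast hn) (gaussianAbsMoment_pos hp1 hp2)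

lemma measurable_lpNorm (n : ℕ) (p : ℝ) :
    Measurable fun x : Fin n → ℝ => (∑ i, |x i| ^ p) ^ (1 / p) := by
  refine Measurable.pow_const (Finset.measurable_sum _ fun i _ => ?_) _
  exact (measurable_abs_rpow p).comp (measurable_pi_apply i)

lemma integrable_mul_sum_sub (hp1 : 1 ≤ p) (hp2 : p ≤ 2) (b c : ℝ) :
    Integrable (fun x : Fin n → ℝ => b * ((∑ i, |x i| ^ p) - c))
      (Measure.pi fun _ : Fin n => gaussianReal 0 1) :=
  ((integrable_sum_abs_rpow hp1 hp2).sub (integrable_const c)).const_mul b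

lemma integrable_lpNorm (hn : 0 < n) (hp1 : 1 ≤ p) (hp2 : p ≤ 2) :
    Integrable (fun x : Fin n → ℝ => (∑ i, |x i| ^ p) ^ (1 / p))
      (Measure.pi fun _ : Fin n => gaussianReal 0 1) := by
  obtain ⟨hq0, hq1⟩ := one_div_mem_of_one_le hp1
  have hr := mul_gaussianAbsMoment_pos hn hp1 hp2
  refine ((integrable_const ((n * gaussianAbsMoment p) ^ (1 / p))).add
    (integrable_mul_sum_sub hp1 hp2 ((n * gaussianAbsMoment p) ^ (1 / p) *
      (1 / p / (n * gaussianAbsMoment p))) (n * gaussianAbsMoment p))).mono'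
    (measurable_lpNorm n p).aestronglyMeasurable (ae_of_all _ fun x => ?_)
  rw [Real.norm_eq_abs, abs_of_nonneg (Real.rpow_nonneg (sum_abs_rpow_nonneg p x) _)]
  exact rpow_le_tangent hq0 hq1 hr (sum_abs_rpow_nonneg p x)

lemma gaussianMeanNorm_le (hn : 0 < n) (hp1 : 1 ≤ p) (hp2 : p ≤ 2) :
    gaussianMeanNorm n p ≤ (n * gaussianAbsMoment p) ^ (1 / p) := by
  obtain ⟨hq0, hq1⟩ := one_div_mem_of_one_le hp1
  have hr := mul_gaussianAbsMoment_pos hn hp1 hp2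
  refine (integral_mono (integrable_lpNorm hn hp1 hp2)
    ((integrable_const _).add (integrable_mul_sum_sub hp1 hp2 _ _))
    fun x => rpow_le_tangent hq0 hq1 hr (sum_abs_rpow_nonneg p x)).trans_eq ?_
  simp only [Pi.add_apply]
  rw [integral_add (integrable_const _) (integrable_mul_sum_sub hp1 hp2 _ _),
    integral_const_mul, integral_sub (integrable_sum_abs_rpow hp1 hp2) (integrable_const _),
    integral_sum_abs_rpow hp1 hp2]
  simp

lemma le_gaussianMeanNorm (hn : 0 < n) (hp1 : 1 ≤ p) (hp2 : p ≤ 2) :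
    (n * gaussianAbsMoment p) ^ (1 / p) *
        (1 - 16 * Real.exp (mgfConst / 64) / gaussianTail 1 / √n) ≤ gaussianMeanNorm n p := by
  obtain ⟨hq0, hq1⟩ := one_div_mem_of_one_le hp1
  have hr := mul_gaussianAbsMoment_pos hn hp1 hp2
  have hn' : (0 : ℝ) < n := by exact_mod_cast hn
  set r := n * gaussianAbsMoment p with hrdef
  have hM : 0 < r ^ (1 / p) := Real.rpow_pos_of_pos hr _
  have hint : Integrable (fun x : Fin n → ℝ => |(∑ i, |x i| ^ p) - r|)
      (Measure.pi fun _ : Fin n => gaussianReal 0 1) :=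
    ((integrable_sum_abs_rpow hp1 hp2).sub (integrable_const r)).abs
  have h1 := integral_mono ((integrable_const (r ^ (1 / p))).sub (integrable_lpNorm hn hp1 hp2))
    ((hint.div_const r).const_mul (r ^ (1 / p))) fun x => by
    have := abs_rpow_sub_rpow_le hq0 hq1 hr (sum_abs_rpow_nonneg p x)
    rw [abs_sub_comm] at this
    exact (le_abs_self _).trans this
  simp only [Pi.sub_apply] at h1
  rw [integral_sub (integrable_const _) (integrable_lpNorm hn hp1 hp2), integral_const_mul,
    integral_div] at h1
  simp only [integral_const, probReal_univ, smul_eq_mul, one_mul] at h1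
  have h2 : (∫ x : Fin n → ℝ, |(∑ i, |x i| ^ p) - r|
      ∂(Measure.pi fun _ : Fin n => gaussianReal 0 1)) / r ≤
      16 * Real.exp (mgfConst / 64) / gaussianTail 1 / √n := by
    have h3 := integral_abs_sum_sub_le hn hp1 hp2
    rw [← hrdef] at h3
    have hθ := gaussianTail_pos 1
    have hθr : n * gaussianTail 1 ≤ r :=
      mul_le_mul_of_nonneg_left (gaussianTail_le_gaussianAbsMoment hp1 hp2) hn'.le
    calc _ ≤ 16 * Real.exp (mgfConst / 64) * √n / (n * gaussianTail 1) := by gcongr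
      _ = _ := by
        have hs : √(n : ℝ) * √n = n := Real.mul_self_sqrt hn'.le
        have hs0 : 0 < √(n : ℝ) := Real.sqrt_pos.2 hn'
        rw [div_div, div_eq_div_iff (by positivity) (by positivity)]
        linear_combination (16 * Real.exp (mgfConst / 64) * gaussianTail 1) * hs
  have h4 := mul_le_mul_of_nonneg_left h2 hM.le
  unfold gaussianMeanNorm
  linarith

lemma measureReal_deviation_le (hn : 0 < n) (hp1 : 1 ≤ p) (hp2 : p ≤ 2) {e : ℝ} (he0 : 0 < e)
    (he1 : e < 1) (hen : 4 * (16 * Real.exp (mgfConst / 64) / gaussianTail 1) ≤ e * √n) :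
    (Measure.pi fun _ : Fin n => gaussianReal 0 1).real
        {x | e * gaussianMeanNorm n p < |(∑ i, |x i| ^ p) ^ (1 / p) - gaussianMeanNorm n p|} ≤
      2 * Real.exp (-chernoffRate * (e / 2) ^ 2 * n) := by
  obtain ⟨hq0, hq1⟩ := one_div_mem_of_one_le hp1
  have hr := mul_gaussianAbsMoment_pos hn hp1 hp2
  have hn' : (0 : ℝ) < n := by exact_mod_cast hn
  have hs0 : 0 < √(n : ℝ) := Real.sqrt_pos.2 hn'
  refine (measureReal_mono fun x hx => ?_).trans
    (measureReal_abs_sum_sub_le hp1 hp2 (by linarith : 0 ≤ e / 2) (by linarith))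
  rw [Set.mem_ofPred_eq] at hx ⊢
  have hle := gaussianMeanNorm_le hn hp1 hp2
  have hge := le_gaussianMeanNorm hn hp1 hp2
  have hN := abs_rpow_sub_rpow_le hq0 hq1 hr (sum_abs_rpow_nonneg p x)
  set r := n * gaussianAbsMoment p
  set D := 16 * Real.exp (mgfConst / 64) / gaussianTail 1
  have hM : 0 < r ^ (1 / p) := Real.rpow_pos_of_pos hr _
  have hD : D / √n ≤ e / 4 := by
    rw [div_le_iff₀ hs0]; linarith
  have hge' : r ^ (1 / p) * (1 - e / 4) ≤ gaussianMeanNorm n p :=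
    (mul_le_mul_of_nonneg_left (by linarith) hM.le).trans hge
  have htri := abs_sub_le ((∑ i, |x i| ^ p) ^ (1 / p)) (r ^ (1 / p)) (gaussianMeanNorm n p)
  rw [abs_of_nonneg (sub_nonneg.2 hle)] at htri
  have hkey : r ^ (1 / p) * (e / 2) ≤ r ^ (1 / p) * (|(∑ i, |x i| ^ p) - r| / r) := by
    nlinarith [mul_le_mul_of_nonneg_left hge' he0.le, mul_pos hM he0,
      mul_pos (mul_pos hM he0) (sub_pos.2 he1)]
  have := le_of_mul_le_mul_left hkey hM
  rwa [le_div_iff₀ hr] at this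

lemma deviation_of_lt_sum (hn : 0 < n) (hp1 : 1 ≤ p) (hp2 : p ≤ 2) {e : ℝ} (he0 : 0 < e)
    (he1 : e < 1) {x : Fin n → ℝ}
    (hx : (1 + 3 * e) * (n * gaussianAbsMoment p) < ∑ i, |x i| ^ p) :
    e * gaussianMeanNorm n p < |(∑ i, |x i| ^ p) ^ (1 / p) - gaussianMeanNorm n p| := by
  have hr := mul_gaussianAbsMoment_pos hn hp1 hp2
  have hle := gaussianMeanNorm_le hn hp1 hp2
  set r := n * gaussianAbsMoment p
  have hp : (1 + e) ^ p ≤ 1 + 3 * e := by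
    have := Real.rpow_le_rpow_of_exponent_le (by linarith : 1 ≤ 1 + e) hp2
    rw [Real.rpow_two] at this
    nlinarith
  have h1 : (1 + e) * r ^ (1 / p) < (∑ i, |x i| ^ p) ^ (1 / p) := by
    have h2 : (1 + e) * r ^ (1 / p) = ((1 + e) ^ p * r) ^ (1 / p) := by
      rw [Real.mul_rpow (by positivity) hr.le, ← Real.rpow_mul (by linarith),
        mul_one_div_cancel (by linarith), Real.rpow_one]
    rw [h2]
    refine Real.rpow_lt_rpow (by positivity) (lt_of_le_of_lt ?_ hx) (by positivity)
    gcongr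
  have h3 := mul_le_mul_of_nonneg_left hle (by linarith : 0 ≤ 1 + e)
  refine lt_of_lt_of_le ?_ (le_abs_self _)
  linarith

end Norm

section LowerBound

variable {n : ℕ} {p : ℝ}

lemma pow_gaussianTail_le (hn : 0 < n) (hp1 : 1 ≤ p) (hp2 : p ≤ 2) {e : ℝ} (he : e ≤ 1) :
    gaussianTail 8 ^ n ≤ (Measure.pi fun _ : Fin n => gaussianReal 0 1).real
      {x | (1 + 3 * e) * (n * gaussianAbsMoment p) < ∑ i, |x i| ^ p} := by
  have h : (Measure.pi fun _ : Fin n => gaussianReal 0 1).real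
      (Set.univ.pi fun _ => {x : ℝ | 8 < |x|}) = gaussianTail 8 ^ n := by
    rw [measureReal_def, Measure.pi_pi, ENNReal.toReal_prod]
    simp [gaussianTail, measureReal_def]
  rw [← h]
  refine measureReal_mono fun x hx => ?_
  simp only [Set.mem_pi, Set.mem_univ, Set.mem_ofPred_eq, true_implies] at hx ⊢
  have : Nonempty (Fin n) := ⟨⟨0, hn⟩⟩
  have h1 : ∑ _i : Fin n, (8 : ℝ) < ∑ i, |x i| ^ p :=
    Finset.sum_lt_sum_of_nonempty Finset.univ_nonempty fun i _ => by
      have := Real.rpow_le_rpow_of_exponent_le (by linarith [hx i] : 1 ≤ |x i|) hp1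
      rw [Real.rpow_one] at this
      linarith [hx i]
  simp only [Finset.sum_const, Finset.card_univ, Fintype.card_fin, nsmul_eq_mul] at h1
  have h2 := gaussianAbsMoment_le_two hp1 hp2
  have h3 := mul_gaussianAbsMoment_pos hn hp1 hp2
  have h4 := mul_le_mul_of_nonneg_left h2 (Nat.cast_nonneg (α := ℝ) n)
  nlinarith

/-- The centred indicator of `{|x| > 1}`, used as a direction of tilting. -/
noncomputable def tiltDirection (x : ℝ) : ℝ :=
  Set.indicator {x : ℝ | 1 < |x|} 1 x - gaussianTail 1

lemma measurable_tiltDirection : Measurable tiltDirection :=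
  (measurable_one.indicator (isOpen_lt_abs 1).measurableSet).sub_const _

lemma tiltDirection_of_lt {x : ℝ} (hx : 1 < |x|) : tiltDirection x = 1 - gaussianTail 1 := by
  simp [tiltDirection, hx]

lemma tiltDirection_of_le {x : ℝ} (hx : |x| ≤ 1) : tiltDirection x = -gaussianTail 1 := by
  simp [tiltDirection, hx]

lemma abs_tiltDirection_le (x : ℝ) : |tiltDirection x| ≤ 1 := by
  have h0 := gaussianTail_pos 1
  have h1 := gaussianTail_one_lt_one
  rw [abs_le]
  rcases le_or_gt |x| 1 with h | h
  · rw [tiltDirection_of_le h]; constructor <;> linarith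
  · rw [tiltDirection_of_lt h]; constructor <;> linarith

lemma integrable_tiltDirection : Integrable tiltDirection (gaussianReal 0 1) :=
  Integrable.of_bound measurable_tiltDirection.aestronglyMeasurable 1
    (ae_of_all _ abs_tiltDirection_le)

lemma integral_tiltDirection : ∫ x, tiltDirection x ∂(gaussianReal 0 1) = 0 := by
  have hm := (isOpen_lt_abs 1).measurableSet
  unfold tiltDirection
  rw [integral_sub ((integrable_const 1).indicator hm) (integrable_const _),
    integral_indicator_one hm]
  simp [gaussianTail]

lemma integrable_tiltDirection_mul (hp1 : 1 ≤ p) (hp2 : p ≤ 2) :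
    Integrable (fun x => tiltDirection x * |x| ^ p) (gaussianReal 0 1) :=
  (integrable_abs_rpow hp1 hp2).bdd_mul measurable_tiltDirection.aestronglyMeasurable (c := 1)
    (ae_of_all _ abs_tiltDirection_le)

/-- A lower bound for the derivative of the moments of `|x|` along `tiltDirection`. -/
noncomputable def tiltGain : ℝ := (1 - gaussianTail 1) * gaussianTail 2

lemma tiltGain_pos : 0 < tiltGain :=
  mul_pos (sub_pos.2 gaussianTail_one_lt_one) (gaussianTail_pos 2)

lemma tiltGain_le_one : tiltGain ≤ 1 :=
  mul_le_one₀ (by linarith [gaussianTail_pos 1]) (gaussianTail_pos 2).le (gaussianTail_le_one 2)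

lemma tiltGain_le (hp1 : 1 ≤ p) (hp2 : p ≤ 2) :
    tiltGain ≤ ∫ x, tiltDirection x * |x| ^ p ∂(gaussianReal 0 1) := by
  have hm := (isOpen_lt_abs 2).measurableSet
  have h0 := gaussianTail_pos 1
  have h1 := gaussianTail_one_lt_one
  have h : ∫ x, (1 - gaussianTail 1) * Set.indicator {x : ℝ | 2 < |x|} 1 x ∂(gaussianReal 0 1) ≤
      ∫ x, (tiltDirection x * |x| ^ p - tiltDirection x) ∂(gaussianReal 0 1) := by
    refine integral_mono (((integrable_const 1).indicator hm).const_mul _)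
      ((integrable_tiltDirection_mul hp1 hp2).sub integrable_tiltDirection) fun x => ?_
    beta_reduce
    rcases le_or_gt |x| 1 with hx | hx
    · have hx2 : ¬ 2 < |x| := by linarith
      have := Real.rpow_le_one (abs_nonneg x) hx (by linarith : 0 ≤ p)
      rw [tiltDirection_of_le hx, Set.indicator_of_notMem (by simpa using hx2)]
      nlinarith
    · have hx1 := Real.rpow_le_rpow_of_exponent_le hx.le hp1
      rw [Real.rpow_one] at hx1
      rw [tiltDirection_of_lt hx]
      by_cases hx2 : 2 < |x|
      · rw [Set.indicator_of_mem (by simpa using hx2), Pi.one_apply]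
        nlinarith
      · rw [Set.indicator_of_notMem (by simpa using hx2)]
        nlinarith
  rw [integral_const_mul, integral_indicator_one hm,
    integral_sub (integrable_tiltDirection_mul hp1 hp2) integrable_tiltDirection,
    integral_tiltDirection, sub_zero] at h
  exact h

lemma integral_tilt_mul (hp1 : 1 ≤ p) (hp2 : p ≤ 2) (t : ℝ) :
    ∫ x, (1 + t * tiltDirection x) * |x| ^ p ∂(gaussianReal 0 1) =
      gaussianAbsMoment p + t * ∫ x, tiltDirection x * |x| ^ p ∂(gaussianReal 0 1) := by
  simp_rw [add_mul, one_mul, mul_assoc]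
  rw [integral_add (integrable_abs_rpow hp1 hp2)
    ((integrable_tiltDirection_mul hp1 hp2).const_mul t), integral_const_mul]
  rfl

lemma integral_tilt (t : ℝ) : ∫ x, (1 + t * tiltDirection x) ∂(gaussianReal 0 1) = 1 := by
  rw [integral_add (integrable_const _) (integrable_tiltDirection.const_mul t),
    integral_const_mul, integral_tiltDirection]
  simp

lemma integrable_tilt_sq (t : ℝ) :
    Integrable (fun x => (1 + t * tiltDirection x) ^ 2) (gaussianReal 0 1) := by
  refine Integrable.of_bound (by have := measurable_tiltDirection; fun_prop) ((1 + |t|) ^ 2)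
    (ae_of_all _ fun x => ?_)
  rw [Real.norm_eq_abs, abs_pow]
  gcongr
  refine (abs_add_le _ _).trans ?_
  rw [abs_one, abs_mul]
  gcongr
  exact mul_le_of_le_one_right (abs_nonneg t) (abs_tiltDirection_le x)

lemma integral_tilt_sq_le (t : ℝ) :
    ∫ x, (1 + t * tiltDirection x) ^ 2 ∂(gaussianReal 0 1) ≤ Real.exp (t ^ 2) := by
  have hi : Integrable (fun x => (1 + t ^ 2) + 2 * t * tiltDirection x) (gaussianReal 0 1) :=
    (integrable_const _).add (integrable_tiltDirection.const_mul _)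
  refine (integral_mono (integrable_tilt_sq t) hi fun x => ?_).trans ?_
  · have : tiltDirection x ^ 2 ≤ 1 := (sq_le_one_iff_abs_le_one _).2 (abs_tiltDirection_le x)
    beta_reduce
    nlinarith [mul_le_mul_of_nonneg_left this (sq_nonneg t)]
  · rw [integral_add (integrable_const _) (integrable_tiltDirection.const_mul _),
      integral_const_mul, integral_tiltDirection]
    have := Real.add_one_le_exp (t ^ 2)
    simp
    linarith

/-- If `A` has probability at least `1 / 2` under the tilted measure, then its Gaussian measure is
bounded below in terms of the second moment of the density. -/
lemma le_measureReal_of_le_setIntegral {t : ℝ} {A : Set (Fin n → ℝ)} (hA : MeasurableSet A)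
    (h : 1 / 2 ≤ ∫ x in A, ∏ i, (1 + t * tiltDirection (x i))
      ∂(Measure.pi fun _ : Fin n => gaussianReal 0 1)) :
    1 / 4 * Real.exp (-t ^ 2 * n) ≤ (Measure.pi fun _ : Fin n => gaussianReal 0 1).real A := by
  set P := Measure.pi fun _ : Fin n => gaussianReal 0 1 with hP
  set V := Real.exp (t ^ 2 * n) with hV
  have hV0 : 0 < V := Real.exp_pos _
  have hi1 : Integrable (fun x : Fin n → ℝ => ∏ i, (1 + t * tiltDirection (x i))) P :=
    Integrable.fintype_prod (f := fun _ x => 1 + t * tiltDirection x) fun _ =>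
      (integrable_const _).add (integrable_tiltDirection.const_mul t)
  have hi2 : Integrable (fun x : Fin n → ℝ => (∏ i, (1 + t * tiltDirection (x i))) ^ 2) P := by
    simp_rw [← Finset.prod_pow]
    exact Integrable.fintype_prod (f := fun _ x => (1 + t * tiltDirection x) ^ 2) fun _ =>
      integrable_tilt_sq t
  have h2 : ∫ x, (∏ i, (1 + t * tiltDirection (x i))) ^ 2 ∂P ≤ V := by
    simp_rw [← Finset.prod_pow]
    rw [integral_fintype_prod_eq_pow (fun x => (1 + t * tiltDirection x) ^ 2), Fintype.card_fin,
      hV, mul_comm _ (n : ℝ), Real.exp_nat_mul]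
    exact pow_le_pow_left₀ (integral_nonneg fun x => sq_nonneg _) (integral_tilt_sq_le t) n
  have h3 : ∫ x in A, ∏ i, (1 + t * tiltDirection (x i)) ∂P ≤
      ∫ x in A, ((∏ i, (1 + t * tiltDirection (x i))) ^ 2 / (4 * V) + V) ∂P := by
    refine setIntegral_mono_on hi1.integrableOn
      ((hi2.div_const _).add (integrable_const V)).integrableOn hA fun x _ => ?_
    rw [← sub_le_iff_le_add, le_div_iff₀ (by positivity)]
    nlinarith [sq_nonneg ((∏ i, (1 + t * tiltDirection (x i))) - 2 * V)]
  rw [integral_add (hi2.div_const _).integrableOn (integrable_const V).integrableOn,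
    integral_div, setIntegral_const, smul_eq_mul] at h3
  have h4 : ∫ x in A, (∏ i, (1 + t * tiltDirection (x i))) ^ 2 ∂P ≤ V :=
    (setIntegral_le_integral hi2 (ae_of_all _ fun x => sq_nonneg _)).trans h2
  have h5 : (∫ x in A, (∏ i, (1 + t * tiltDirection (x i))) ^ 2 ∂P) / (4 * V) ≤ 1 / 4 := by
    rw [div_le_iff₀ (by positivity)]
    linarith
  have h6 : 1 / 4 ≤ P.real A * V := by linarith
  rw [neg_mul, Real.exp_neg, ← hV, ← div_eq_mul_inv, div_le_iff₀ hV0]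
  exact h6

lemma measureReal_lt_sum_ge_of_large (hp1 : 1 ≤ p) (hp2 : p ≤ 2) {e : ℝ} (he0 : 0 ≤ e)
    (he1 : 8 / tiltGain * e ≤ 1) (hen : Real.log 2 ≤ chernoffRate * e ^ 2 * n) :
    1 / 4 * Real.exp (-(8 / tiltGain * e) ^ 2 * n) ≤
      (Measure.pi fun _ : Fin n => gaussianReal 0 1).real
        {x | (1 + 3 * e) * (n * gaussianAbsMoment p) < ∑ i, |x i| ^ p} := by
  have hg0 := tiltGain_pos
  have hm2 := gaussianAbsMoment_le_two hp1 hp2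
  have hm0 := gaussianAbsMoment_pos hp1 hp2
  set t := 8 / tiltGain * e with ht
  have ht0 : 0 ≤ t := by positivity
  have he : e ≤ 1 := by
    have : e ≤ t := le_mul_of_one_le_left he0 (by
      rw [one_le_div hg0]; linarith [tiltGain_le_one])
    linarith
  have hw : Measurable fun x => 1 + t * tiltDirection x :=
    (measurable_tiltDirection.const_mul t).const_add 1
  have habs : ∀ x, |t * tiltDirection x| ≤ 1 := fun x => by
    rw [abs_mul, abs_of_nonneg ht0]
    exact mul_le_one₀ he1 (abs_nonneg _) (abs_tiltDirection_le x)
  have hw0 : ∀ x, 0 ≤ 1 + t * tiltDirection x := fun x => by linarith [(abs_le.1 (habs x)).1]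
  have hw2 : ∀ x, 1 + t * tiltDirection x ≤ 2 := fun x => by linarith [(abs_le.1 (habs x)).2]
  have hA : MeasurableSet
      {x : Fin n → ℝ | (1 + 3 * e) * (n * gaussianAbsMoment p) < ∑ i, |x i| ^ p} :=
    measurableSet_lt measurable_const (Finset.measurable_sum _ fun i _ =>
      (measurable_abs_rpow p).comp (measurable_pi_apply i))
  refine le_measureReal_of_le_setIntegral hA ?_
  have hl := abs_chernoffSlope_mul_le he0 he
  have hch := setIntegral_prod_le (n := n) hw hw0 hw2 (integral_tilt t) (measurable_abs_rpow p)
    (abs_rpow_nonneg p) (abs_rpow_le_one_add_sq hp1 hp2) ((abs_neg _).trans_le hl)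
    (chernoffSlope * e ^ 2 * gaussianAbsMoment p * n)
  rw [neg_sq, integral_tilt_mul hp1 hp2] at hch
  simp only [sum_abs_rpow_sub] at hch
  set κ := ∫ x, tiltDirection x * |x| ^ p ∂(gaussianReal 0 1) with hκ
  have hmean : 4 * e * gaussianAbsMoment p ≤ t * κ := by
    have h1 : t * tiltGain = 8 * e := by rw [ht]; field_simp
    have h2 := mul_le_mul_of_nonneg_left (tiltGain_le hp1 hp2) ht0
    nlinarith
  have hi : Integrable (fun x : Fin n → ℝ => ∏ i, (1 + t * tiltDirection (x i)))
      (Measure.pi fun _ : Fin n => gaussianReal 0 1) :=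
    Integrable.fintype_prod (f := fun _ x => 1 + t * tiltDirection x) fun _ =>
      integrable_of_nonneg_of_le_two hw hw0 hw2
  have htot : ∫ x : Fin n → ℝ, ∏ i, (1 + t * tiltDirection (x i))
      ∂(Measure.pi fun _ : Fin n => gaussianReal 0 1) = 1 := by
    rw [integral_fintype_prod_eq_pow (fun x => 1 + t * tiltDirection x), integral_tilt, one_pow]
  have hsplit := integral_add_compl hA hi
  rw [htot] at hsplit
  have hcompl : ∫ x in {x : Fin n → ℝ |
        (1 + 3 * e) * (n * gaussianAbsMoment p) < ∑ i, |x i| ^ p}ᶜ,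
        ∏ i, (1 + t * tiltDirection (x i)) ∂(Measure.pi fun _ : Fin n => gaussianReal 0 1) ≤
      1 / 2 := by
    refine (setIntegral_mono_set hi.integrableOn
      (ae_of_all _ fun x => Finset.prod_nonneg fun i _ => hw0 _)
      (LE.le.eventuallyLE fun x hx => ?_)).trans (hch.trans ?_)
    · simp only [Set.mem_compl_iff, Set.mem_ofPred_eq, not_lt] at hx ⊢
      have hn0 : (0 : ℝ) ≤ n := n.cast_nonneg
      have h1 := mul_le_mul_of_nonneg_left hmean hn0
      have h2 : e * gaussianAbsMoment p * n ≤
          n * (gaussianAbsMoment p + t * κ) - ∑ i, |x i| ^ p := by linarith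
      have h3 := mul_le_mul_of_nonneg_left h2 (mul_nonneg chernoffSlope_pos.le he0)
      linarith
    · refine (Real.exp_le_exp.2 ((chernoff_exponent_le hp1 hp2 e n).trans
        (by linarith : _ ≤ -Real.log 2))).trans_eq ?_
      rw [Real.exp_neg, Real.exp_log two_pos, one_div]
  linarith

lemma exists_le_measureReal_lt_sum : ∃ c C : ℝ, 0 < c ∧ 0 < C ∧
    ∀ (n : ℕ), 0 < n → ∀ p : ℝ, 1 ≤ p → p ≤ 2 → ∀ e : ℝ, 0 < e → e < 1 →
      c * Real.exp (-C * e ^ 2 * n) ≤ (Measure.pi fun _ : Fin n => gaussianReal 0 1).real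
        {x | (1 + 3 * e) * (n * gaussianAbsMoment p) < ∑ i, |x i| ^ p} := by
  set a := 8 / tiltGain with ha
  set B := Real.log 2 / chernoffRate with hB
  set L := -Real.log (gaussianTail 8) with hL
  have ha0 : 0 < a := div_pos (by norm_num) tiltGain_pos
  have hB0 : 0 < B := div_pos (Real.log_pos one_lt_two) chernoffRate_pos
  have hL0 : 0 ≤ L := by
    have := Real.log_nonpos (gaussianTail_pos 8).le (gaussianTail_le_one 8)
    linarith
  refine ⟨1 / 4 * Real.exp (-(a ^ 2 * B + L * a ^ 2 * B)), a ^ 2 + L * a ^ 2, by positivity,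
    by positivity, fun n hn p hp1 hp2 e he0 he1 => ?_⟩
  have hn' : (0 : ℝ) < n := by exact_mod_cast hn
  rw [mul_assoc, ← Real.exp_add]
  have hmono : ∀ e' : ℝ, e ≤ e' → (Measure.pi fun _ : Fin n => gaussianReal 0 1).real
        {x | (1 + 3 * e') * (n * gaussianAbsMoment p) < ∑ i, |x i| ^ p} ≤
      (Measure.pi fun _ : Fin n => gaussianReal 0 1).real
        {x | (1 + 3 * e) * (n * gaussianAbsMoment p) < ∑ i, |x i| ^ p} := fun e' h =>
    measureReal_mono fun x hx => lt_of_le_of_lt (mul_le_mul_of_nonneg_right (by linarith)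
      (mul_gaussianAbsMoment_pos hn hp1 hp2).le) hx
  have hP1 : 0 ≤ a ^ 2 * B := by positivity
  have hP2 : 0 ≤ L * a ^ 2 * B := by positivity
  have hP3 : 0 ≤ a ^ 2 * e ^ 2 * n := by positivity
  have hP4 : 0 ≤ L * a ^ 2 * e ^ 2 * n := by positivity
  have hpow : gaussianTail 8 ^ n = Real.exp (-(L * n)) := by
    rw [hL, neg_mul, neg_neg, mul_comm, Real.exp_nat_mul, Real.exp_log (gaussianTail_pos 8)]
  have hsmall : ∀ s : ℝ, n ≤ a ^ 2 * s → s ≤ B + e ^ 2 * n →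
      1 / 4 * Real.exp (-(a ^ 2 * B + L * a ^ 2 * B) + -(a ^ 2 + L * a ^ 2) * e ^ 2 * n) ≤
      (Measure.pi fun _ : Fin n => gaussianReal 0 1).real
        {x | (1 + 3 * e) * (n * gaussianAbsMoment p) < ∑ i, |x i| ^ p} := by
    intro s hs hsB
    refine le_trans ?_ (pow_gaussianTail_le hn hp1 hp2 he1.le)
    rw [hpow]
    refine (mul_le_of_le_one_left (Real.exp_pos _).le (by norm_num)).trans (Real.exp_le_exp.2 ?_)
    have h1 : L * n ≤ L * (a ^ 2 * s) := mul_le_mul_of_nonneg_left hs hL0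
    have h2 : L * a ^ 2 * s ≤ L * a ^ 2 * (B + e ^ 2 * n) :=
      mul_le_mul_of_nonneg_left hsB (by positivity)
    linarith
  rcases le_or_gt (n : ℝ) (a ^ 2 * B) with hcase | hcase
  · exact hsmall B hcase (by nlinarith [mul_nonneg (sq_nonneg e) hn'.le])
  rcases le_or_gt 1 (a * e) with hae | hae
  · refine hsmall (e ^ 2 * n) ?_ (by linarith)
    have : 1 ≤ (a * e) ^ 2 := one_le_pow₀ hae
    nlinarith
  set e' := max e √(B / n) with he'
  have hsq : √(B / n) ^ 2 = B / n := Real.sq_sqrt (by positivity)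
  have hs1 : a * √(B / n) ≤ 1 := by
    rw [← abs_of_nonneg (by positivity : 0 ≤ a * √(B / n)), ← sq_le_one_iff_abs_le_one, mul_pow,
      hsq, ← mul_div_assoc, div_le_one hn']
    exact hcase.le
  have he'0 : 0 ≤ e' := he0.le.trans (le_max_left _ _)
  have he'1 : a * e' ≤ 1 := by
    rw [he', mul_max_of_nonneg _ _ ha0.le]
    exact max_le hae.le hs1
  have he'B : B ≤ e' ^ 2 * n := by
    have : B / n ≤ e' ^ 2 := by
      rw [← hsq]
      exact pow_le_pow_left₀ (Real.sqrt_nonneg _) (le_max_right _ _) 2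
    rwa [div_le_iff₀ hn'] at this
  have he'n : e' ^ 2 * n ≤ e ^ 2 * n + B := by
    have hBn : B / n * n = B := div_mul_cancel₀ _ hn'.ne'
    rcases max_choice e √(B / n) with h | h
    · rw [he', h]; linarith
    · rw [he', h, hsq, hBn]; nlinarith [mul_nonneg (sq_nonneg e) hn'.le]
  have hlog : Real.log 2 ≤ chernoffRate * e' ^ 2 * n := by
    rw [hB, div_le_iff₀ chernoffRate_pos] at he'B
    linarith
  refine le_trans ?_ ((measureReal_lt_sum_ge_of_large hp1 hp2 he'0 he'1 hlog).trans
    (hmono e' (le_max_left _ _)))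
  gcongr
  have := mul_le_mul_of_nonneg_left he'n (sq_nonneg a)
  rw [mul_pow]
  linarith

end LowerBound

theorem stmt12 :
    ∃ c₁ C₁ c₂ C₂ : ℝ, 0 < c₁ ∧ 0 < C₁ ∧ 0 < c₂ ∧ 0 < C₂ ∧
      ∀ (n : ℕ), 0 < n → ∀ p : ℝ, 1 ≤ p → p ≤ 2 → ∀ ε : ℝ, 0 < ε → ε < 1 →
        c₁ * Real.exp (-C₁ * ε ^ 2 * n) ≤
          ((Measure.pi fun _ : Fin n => gaussianReal 0 1)
            {x | ε * ∫ y, (∑ i, |y i| ^ p) ^ (1 / p)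
                  ∂(Measure.pi fun _ : Fin n => gaussianReal 0 1) <
              |(∑ i, |x i| ^ p) ^ (1 / p) -
                ∫ y, (∑ i, |y i| ^ p) ^ (1 / p)
                  ∂(Measure.pi fun _ : Fin n => gaussianReal 0 1)|}).toReal ∧
        ((Measure.pi fun _ : Fin n => gaussianReal 0 1)
            {x | ε * ∫ y, (∑ i, |y i| ^ p) ^ (1 / p)
                  ∂(Measure.pi fun _ : Fin n => gaussianReal 0 1) <
              |(∑ i, |x i| ^ p) ^ (1 / p) -
                ∫ y, (∑ i, |y i| ^ p) ^ (1 / p)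
                  ∂(Measure.pi fun _ : Fin n => gaussianReal 0 1)|}).toReal ≤
          C₂ * Real.exp (-c₂ * ε ^ 2 * n) := by
  obtain ⟨c, C, hc, hC, hlow⟩ := exists_le_measureReal_lt_sum
  set D := 4 * (16 * Real.exp (mgfConst / 64) / gaussianTail 1) with hD
  have hD0 : 0 < D := by
    have := gaussianTail_pos 1
    positivity
  have hrate := chernoffRate_pos
  refine ⟨c, C, chernoffRate / 4, 2 * Real.exp (chernoffRate / 4 * D ^ 2), hc, hC, by positivity,
    by positivity, fun n hn p hp1 hp2 e he0 he1 => ⟨?_, ?_⟩⟩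
  · exact (hlow n hn p hp1 hp2 e he0 he1).trans
      (measureReal_mono fun x hx => deviation_of_lt_sum hn hp1 hp2 he0 he1 hx)
  · rw [mul_assoc, ← Real.exp_add]
    rcases le_or_gt D (e * √n) with h | h
    · refine (measureReal_deviation_le hn hp1 hp2 he0 he1 h).trans ?_
      gcongr
      have : 0 ≤ chernoffRate / 4 * D ^ 2 := by positivity
      linarith
    · have h1 : e ^ 2 * n ≤ D ^ 2 := by
        have h2 := pow_le_pow_left₀ (by positivity) h.le 2
        rwa [mul_pow, Real.sq_sqrt n.cast_nonneg] at h2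
      refine (measureReal_le_one (μ := Measure.pi fun _ : Fin n => gaussianReal 0 1)).trans ?_
      have h3 : 1 ≤ Real.exp (chernoffRate / 4 * D ^ 2 + -(chernoffRate / 4) * e ^ 2 * n) := by
        refine Real.one_le_exp ?_
        nlinarith
      linarith
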